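/- There exists a constant C > 0 such that for every prime power q there is a normal subset A of G = PSL₃(𝔽_q) with |A| ≥ (|G|/2)·(1 − C/q) and A ∩ A⁻¹ = ∅ (equivalently, the identity element does not lie in A²). -/

import Mathlib

open scoped Pointwise

section Averaging

/-- If almost every translate orbit `s ↦ u s * g` meets `S` for at most `k` parameters, then `S`
has density at most `k / |F|`, up to the exceptional set `T`. -/
theorem card_mul_card_le_of_translates {G F : Type*} [Group G] [Finite G] [Fintype F]
    (u : F → G) (S T : Set G) (k : ℕ)
    (h : ∀ g ∉ T, {s : F | u s * g ∈ S}.ncard ≤ k) :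
    Fintype.card F * S.ncard ≤ k * Nat.card G + Fintype.card F * T.ncard := by
  classical
  have := Fintype.ofFinite G
  have hleft : ∑ s : F, ∑ g : G, (if u s * g ∈ S then 1 else 0) = Fintype.card F * S.ncard := by
    have hs (s : F) : ∑ g : G, (if u s * g ∈ S then 1 else 0) = S.ncard := by
      refine (Equiv.sum_comp (Equiv.mulLeft (u s)) (fun g => if g ∈ S then 1 else 0)).trans ?_
      rw [Set.ncard_eq_toFinset_card', ← Finset.card_filter]
      congr 1
      ext
      simp
    simp [hs]
  have hright (g : G) : ∑ s : F, (if u s * g ∈ S then 1 else 0) ≤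
      k + Fintype.card F * (if g ∈ T then 1 else 0) := by
    have hcard : ∑ s : F, (if u s * g ∈ S then 1 else 0) = {s : F | u s * g ∈ S}.ncard := by
      rw [Set.ncard_eq_toFinset_card', ← Finset.card_filter]
      congr 1
      ext
      simp
    rw [hcard]
    by_cases hg : g ∈ T
    · have : {s : F | u s * g ∈ S}.ncard ≤ Fintype.card F := by
        rw [← Nat.card_eq_fintype_card, ← Set.ncard_univ]
        exact Set.ncard_le_ncard (Set.subset_univ _)
      simp only [hg, if_true]
      lia
    · simpa [hg] using h g hg
  have hT : ∑ g : G, (if g ∈ T then 1 else 0) = T.ncard := by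
    rw [Set.ncard_eq_toFinset_card', ← Finset.card_filter]
    congr 1
    ext
    simp
  calc Fintype.card F * S.ncard
      = ∑ g : G, ∑ s : F, (if u s * g ∈ S then 1 else 0) := by rw [← hleft, Finset.sum_comm]
    _ ≤ ∑ g : G, (k + Fintype.card F * (if g ∈ T then 1 else 0)) :=
        Finset.sum_le_sum fun g _ => hright g
    _ = k * Nat.card G + Fintype.card F * T.ncard := by
        rw [Finset.sum_add_distrib, ← Finset.mul_sum, hT]
        simp [mul_comm]

open Polynomial in
theorem ncard_roots_le_natDegree {F : Type*} [Field F] (p : F[X]) (hp : p ≠ 0) :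
    {s : F | p.eval s = 0}.ncard ≤ p.natDegree := by
  classical
  calc {s : F | p.eval s = 0}.ncard = p.roots.toFinset.card := by
        rw [← Set.ncard_coe_finset]
        congr 1
        ext s
        simp [hp]
    _ ≤ p.natDegree := (Multiset.toFinset_card_le _).trans p.card_roots'

open Polynomial in
theorem ncard_cubic_roots_le {F : Type*} [Field F] (a b c d : F) (ha : a ≠ 0) :
    {s : F | a * s ^ 3 + b * s ^ 2 + c * s + d = 0}.ncard ≤ 3 := by
  have h := ncard_roots_le_natDegree (C a * X ^ 3 + C b * X ^ 2 + C c * X + C d)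
    (fun h0 => ha (by simpa using congrArg (fun p => p.coeff 3) h0))
  rw [natDegree_cubic ha] at h
  simpa using h

open Polynomial in
theorem ncard_quadratic_roots_le {F : Type*} [Field F] (a b c : F)
    (h : a ≠ 0 ∨ b ≠ 0 ∨ c ≠ 0) :
    {s : F | a * s ^ 2 + b * s + c = 0}.ncard ≤ 2 := by
  have h' := ncard_roots_le_natDegree (C a * X ^ 2 + C b * X + C c) (fun h0 => by
    have h0' (i : ℕ) := congrArg (fun p => p.coeff i) h0
    have h2 := h0' 2
    have h1 := h0' 1
    have h00 := h0' 0
    simp [coeff_X, coeff_C] at h2 h1 h00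
    simp_all)
  refine le_trans ?_ (h'.trans natDegree_quadratic_le)
  simp

end Averaging

namespace Matrix.SpecialLinearGroup

variable {F : Type*} [Field F]

/-- The transvection adding `s` times row `0` to row `1`. -/
def transvectionOneZero (s : F) : SpecialLinearGroup (Fin 3) F :=
  ⟨!![1, 0, 0; s, 1, 0; 0, 0, 1], by simp [Matrix.det_fin_three]⟩

/-- The transvection adding `s` times row `1` to row `2`. -/
def transvectionTwoOne (s : F) : SpecialLinearGroup (Fin 3) F :=
  ⟨!![1, 0, 0; 0, 1, 0; 0, s, 1], by simp [Matrix.det_fin_three]⟩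

/-- A curve of unipotent matrices whose inverses have last column `(s², s, 1)`. -/
def unipotentCurve (s : F) : SpecialLinearGroup (Fin 3) F :=
  ⟨!![1, 0, -s ^ 2; 0, 1, -s; 0, 0, 1], by simp [Matrix.det_fin_three]⟩

theorem coe_inv_transvectionOneZero (s : F) :
    ((transvectionOneZero s)⁻¹ : SpecialLinearGroup (Fin 3) F).1 =
      !![1, 0, 0; -s, 1, 0; 0, 0, 1] := by
  rw [coe_inv]
  simp [transvectionOneZero, Matrix.adjugate_fin_three]

theorem coe_inv_transvectionTwoOne (s : F) :
    ((transvectionTwoOne s)⁻¹ : SpecialLinearGroup (Fin 3) F).1 =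
      !![1, 0, 0; 0, 1, 0; 0, -s, 1] := by
  rw [coe_inv]
  simp [transvectionTwoOne, Matrix.adjugate_fin_three]

theorem coe_inv_unipotentCurve (s : F) :
    ((unipotentCurve s)⁻¹ : SpecialLinearGroup (Fin 3) F).1 =
      !![1, 0, s ^ 2; 0, 1, s; 0, 0, 1] := by
  rw [coe_inv]
  simp [unipotentCurve, Matrix.adjugate_fin_three]

theorem exists_apply_zero_ne_zero (h : SpecialLinearGroup (Fin 3) F) :
    h.1 0 0 ≠ 0 ∨ h.1 0 1 ≠ 0 ∨ h.1 0 2 ≠ 0 := by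
  by_contra! h0
  have hdet := h.det_coe
  rw [Matrix.det_fin_three, h0.1, h0.2.1, h0.2.2] at hdet
  simp at hdet

variable [Fintype F]

theorem card_mul_card_inv_apply_zero_two_eq_zero_le :
    Fintype.card F * {g : SpecialLinearGroup (Fin 3) F | (g⁻¹).1 0 2 = 0}.ncard ≤
      2 * Nat.card (SpecialLinearGroup (Fin 3) F) := by
  have := card_mul_card_le_of_translates unipotentCurve
    {g : SpecialLinearGroup (Fin 3) F | (g⁻¹).1 0 2 = 0} ∅ 2 fun g _ => by
      refine le_trans (le_of_eq ?_) (ncard_quadratic_roots_le _ _ _ (exists_apply_zero_ne_zero g⁻¹))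
      congr 1
      ext s
      rw [Set.mem_ofPred_eq, Set.mem_ofPred_eq, _root_.mul_inv_rev, coe_mul, coe_inv_unipotentCurve]
      simp [Matrix.mul_apply, Fin.sum_univ_three]
  simpa using this

theorem card_mul_card_entry_cube_le :
    Fintype.card F * {g : SpecialLinearGroup (Fin 3) F |
        g.1 0 1 ^ 3 + (g⁻¹).1 0 1 ^ 3 = 0}.ncard ≤
      5 * Nat.card (SpecialLinearGroup (Fin 3) F) := by
  have := card_mul_card_le_of_translates transvectionTwoOne
    {g : SpecialLinearGroup (Fin 3) F | g.1 0 1 ^ 3 + (g⁻¹).1 0 1 ^ 3 = 0}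
    {g : SpecialLinearGroup (Fin 3) F | (g⁻¹).1 0 2 = 0} 3 fun g hg => by
      set k := g.1 0 1 with hk
      set h := (g⁻¹).1 0 1 with hh
      set m := (g⁻¹).1 0 2 with hm
      have hm0 : -m ^ 3 ≠ 0 := neg_ne_zero.2 (pow_ne_zero 3 hg)
      refine le_trans (le_of_eq ?_)
        (ncard_cubic_roots_le _ (3 * h * m ^ 2) (-3 * h ^ 2 * m) (k ^ 3 + h ^ 3) hm0)
      congr 1
      ext s
      have h1 : (transvectionTwoOne s * g).1 0 1 = k := by
        rw [coe_mul, Matrix.mul_apply, hk]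
        simp [transvectionTwoOne, Fin.sum_univ_three]
      have h2 : ((transvectionTwoOne s * g)⁻¹).1 0 1 = h - s * m := by
        rw [_root_.mul_inv_rev, coe_mul, coe_inv_transvectionTwoOne, hh, hm]
        simp only [Matrix.mul_apply, Fin.sum_univ_three]
        simp
        ring
      simp only [Set.mem_ofPred_eq, h1, h2]
      ring_nf
  have h2 := card_mul_card_inv_apply_zero_two_eq_zero_le (F := F)
  lia

theorem card_mul_card_trace_cube_le :
    Fintype.card F * {g : SpecialLinearGroup (Fin 3) F |
        g.1.trace ^ 3 = (g⁻¹).1.trace ^ 3}.ncard ≤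
      8 * Nat.card (SpecialLinearGroup (Fin 3) F) := by
  have := card_mul_card_le_of_translates transvectionOneZero
    {g : SpecialLinearGroup (Fin 3) F | g.1.trace ^ 3 = (g⁻¹).1.trace ^ 3}
    {g : SpecialLinearGroup (Fin 3) F | g.1 0 1 ^ 3 + (g⁻¹).1 0 1 ^ 3 = 0} 3 fun g hg => by
      set a := g.1.trace with ha
      set b := (g⁻¹).1.trace with hb
      set k := g.1 0 1 with hk
      set h := (g⁻¹).1 0 1 with hh
      refine le_trans (le_of_eq ?_)
        (ncard_cubic_roots_le (k ^ 3 + h ^ 3) (3 * a * k ^ 2 - 3 * b * h ^ 2)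
          (3 * a ^ 2 * k + 3 * b ^ 2 * h) (a ^ 3 - b ^ 3) hg)
      congr 1
      ext s
      have h1 : (transvectionOneZero s * g).1.trace = a + s * k := by
        rw [coe_mul, ha, hk]
        simp only [Matrix.trace_fin_three, Matrix.mul_apply, Fin.sum_univ_three]
        simp [transvectionOneZero]
        ring
      have h2 : ((transvectionOneZero s * g)⁻¹).1.trace = b - s * h := by
        rw [_root_.mul_inv_rev, coe_mul, coe_inv_transvectionOneZero, hb, hh]
        simp only [Matrix.trace_fin_three, Matrix.mul_apply, Fin.sum_univ_three]
        simp
        ring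
      simp only [Set.mem_ofPred_eq, h1, h2]
      rw [← sub_eq_zero]
      ring_nf
  have h2 := card_mul_card_entry_cube_le (F := F)
  lia

theorem trace_pow_eq_of_mk_eq {n R : Type*} [Fintype n] [DecidableEq n] [CommRing R]
    {g h : SpecialLinearGroup n R}
    (hgh : (g : ProjectiveSpecialLinearGroup n R) = (h : ProjectiveSpecialLinearGroup n R)) :
    g.1.trace ^ Fintype.card n = h.1.trace ^ Fintype.card n := by
  obtain ⟨r, hr, hz⟩ := mem_center_iff.1 (QuotientGroup.eq.1 hgh)
  have hh : h = g * (g⁻¹ * h) := by group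
  rw [hh, coe_mul, ← hz, scalar_apply, trace]
  simp [trace, ← Finset.sum_mul, mul_pow, hr]

end Matrix.SpecialLinearGroup

namespace Matrix.ProjectiveSpecialLinearGroup

open Matrix.SpecialLinearGroup

/-- The power of the trace which is invariant under scalar matrices of determinant one. -/
def tracePow {n R : Type*} [Fintype n] [DecidableEq n] [CommRing R] :
    ProjectiveSpecialLinearGroup n R → R :=
  Quotient.lift (fun g : SpecialLinearGroup n R => g.1.trace ^ Fintype.card n)
    fun _ _ h => trace_pow_eq_of_mk_eq (Quotient.sound h)

theorem tracePow_mk {n R : Type*} [Fintype n] [DecidableEq n] [CommRing R]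
    (g : SpecialLinearGroup n R) :
    tracePow (g : ProjectiveSpecialLinearGroup n R) = g.1.trace ^ Fintype.card n :=
  rfl

theorem tracePow_conj {n R : Type*} [Fintype n] [DecidableEq n] [CommRing R]
    (g a : ProjectiveSpecialLinearGroup n R) : tracePow (g * a * g⁻¹) = tracePow a := by
  obtain ⟨g, rfl⟩ := QuotientGroup.mk_surjective g
  obtain ⟨a, rfl⟩ := QuotientGroup.mk_surjective a
  rw [← QuotientGroup.mk_inv, ← QuotientGroup.mk_mul, ← QuotientGroup.mk_mul, tracePow_mk,
    tracePow_mk, coe_mul, trace_mul_comm, ← coe_mul]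
  group

theorem card_mul_card_tracePow_eq_le {F : Type*} [Field F] [Fintype F] :
    Fintype.card F * {x : ProjectiveSpecialLinearGroup (Fin 3) F |
        tracePow x = tracePow x⁻¹}.ncard ≤
      8 * Nat.card (ProjectiveSpecialLinearGroup (Fin 3) F) := by
  have h := card_mul_card_trace_cube_le (F := F)
  have hN := QuotientGroup.card_preimage_mk (Subgroup.center (SpecialLinearGroup (Fin 3) F))
    {x : ProjectiveSpecialLinearGroup (Fin 3) F | tracePow x = tracePow x⁻¹}
  have hpre : (QuotientGroup.mk ⁻¹' {x : ProjectiveSpecialLinearGroup (Fin 3) F |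
      tracePow x = tracePow x⁻¹} : Set (SpecialLinearGroup (Fin 3) F)) =
      {g | g.1.trace ^ 3 = (g⁻¹).1.trace ^ 3} :=
    rfl
  rw [hpre, Nat.card_coe_set_eq, Nat.card_coe_set_eq] at hN
  rw [hN, Subgroup.card_eq_card_quotient_mul_card_subgroup
    (Subgroup.center (SpecialLinearGroup (Fin 3) F))] at h
  refine Nat.le_of_mul_le_mul_left (c := Nat.card (Subgroup.center (SpecialLinearGroup (Fin 3) F)))
    ?_ Nat.card_pos
  calc _ = _ := by ring
    _ ≤ _ := h
    _ = _ := by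
      rw [mul_comm (Nat.card (_ ⧸ _)), mul_left_comm]

end Matrix.ProjectiveSpecialLinearGroup

open Matrix.ProjectiveSpecialLinearGroup

theorem stmt17 :
    ∃ C : ℝ, 0 < C ∧
      ∀ q : ℕ, IsPrimePow q →
      ∀ (F : Type) [Field F] [Fintype F], Fintype.card F = q →
      ∃ A : Set (Matrix.ProjectiveSpecialLinearGroup (Fin 3) F),
        (∀ a ∈ A, ∀ g, g * a * g⁻¹ ∈ A) ∧
        (A.ncard : ℝ) ≥
          (Nat.card (Matrix.ProjectiveSpecialLinearGroup (Fin 3) F) : ℝ) / 2 *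
            (1 - C / (q : ℝ)) ∧
        A ∩ A⁻¹ = ∅ := by
  refine ⟨8, by norm_num, fun q _ F _ _ hF => ?_⟩
  let e := Fintype.equivFin F
  let A : Set (Matrix.ProjectiveSpecialLinearGroup (Fin 3) F) :=
    {x | e (tracePow x) < e (tracePow x⁻¹)}
  let N : Set (Matrix.ProjectiveSpecialLinearGroup (Fin 3) F) :=
    {x | tracePow x = tracePow x⁻¹}
  have : Finite (Matrix.ProjectiveSpecialLinearGroup (Fin 3) F) :=
    Quotient.finite _
  refine ⟨A, fun a ha g => ?_, ?_, ?_⟩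
  · have hinv : (g * a * g⁻¹)⁻¹ = g * a⁻¹ * g⁻¹ := by group
    change e (tracePow (g * a * g⁻¹)) < e (tracePow (g * a * g⁻¹)⁻¹)
    rw [hinv, tracePow_conj, tracePow_conj]
    exact ha
  · have hcover : (Set.univ : Set (Matrix.ProjectiveSpecialLinearGroup (Fin 3) F)) =
        A ∪ A⁻¹ ∪ N := by
      ext x
      rcases lt_trichotomy (e (tracePow x)) (e (tracePow x⁻¹)) with h | h | h
      · simp [A, h]
      · simp [N, e.injective h]
      · simp [A, h]
    have hcard : Nat.card (Matrix.ProjectiveSpecialLinearGroup (Fin 3) F) ≤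
        2 * A.ncard + N.ncard := by
      have h1 := Set.ncard_union_le (A ∪ A⁻¹) N
      have h2 := Set.ncard_union_le A A⁻¹
      rw [← hcover, Set.ncard_univ] at h1
      rw [Set.ncard_inv] at h2
      lia
    have hN : Fintype.card F * N.ncard ≤ _ := card_mul_card_tracePow_eq_le
    have hq : (0 : ℝ) < q := by
      rw [← hF]
      exact_mod_cast Fintype.card_pos
    rw [hF] at hN
    have hN' : (N.ncard : ℝ) ≤
        8 * Nat.card (Matrix.ProjectiveSpecialLinearGroup (Fin 3) F) / q := by
      rw [le_div_iff₀ hq, mul_comm]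
      exact_mod_cast hN
    have hcard' : (Nat.card (Matrix.ProjectiveSpecialLinearGroup (Fin 3) F) : ℝ) ≤
        2 * A.ncard + N.ncard := by
      exact_mod_cast hcard
    calc (Nat.card (Matrix.ProjectiveSpecialLinearGroup (Fin 3) F) : ℝ) / 2 * (1 - 8 / q)
        = (Nat.card (Matrix.ProjectiveSpecialLinearGroup (Fin 3) F) -
            8 * Nat.card (Matrix.ProjectiveSpecialLinearGroup (Fin 3) F) / q) / 2 := by ring
      _ ≤ A.ncard := by linarith
  · ext x
    simp only [A, Set.mem_inter_iff, Set.mem_inv, Set.mem_ofPred_eq, inv_inv,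
      Set.mem_empty_iff_false, iff_false, not_and, not_lt]
    exact le_of_lt
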